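/- Let k > 0 and let ζ_{i−1} < ζ_i < ζ_{i+1} be real numbers; set Ω_{i−1} = {x ∈ ℝ² : ζ_{i−1} < x₂ < ζ_i}, Ω_i = {x ∈ ℝ² : ζ_i < x₂ < ζ_{i+1}} and H = {y ∈ ℝ² : y₂ > ζ_{i−1}}. Let a₁, a₂, J : ℝ² → ℂ be C¹ functions that are bounded, with bounded first derivatives, on H. Assume: (a) u : ℝ² → ℂ is C² and satisfies ∂₁(a₁∂₁u) + ∂₂(a₂∂₂u) + k²Ju = −J·f̄ on ℝ², where f̄ : ℝ² → ℂ is bounded and supported in the closure of Ω_i; (b) there is ζ′ < ζ_{i−1} such that g : ℝ² → ℂ is C² and satisfies ∂₁(a₁∂₁g) + ∂₂(a₂∂₂g) + k²Jg = 0 on {y : y₂ > ζ′}; (c) there exist C, c > 0 with |u(y)| + |∇u(y)| + |g(y)| + |∇g(y)| ≤ C·e^{−c|y|} for all y ∈ H; (d) β : ℝ → ℝ is C² with β(t) = 0 for t ≤ ζ_{i−1} and β(t) = 1 for t ≥ ζ_i. Define Ψ(y) = ∂₁(a₁∂₁(βu))(y) + ∂₂(a₂∂₂(βu))(y) + k²J(y)β(y₂)u(y),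 where (βu)(y) = β(y₂)u(y). Then ∫_{Ω_i} f̄(y)·J(y)·g(y) dy = ∫_{Ω_{i−1}} Ψ(y)·g(y) dy. -/

import Mathlib

open MeasureTheory

/-- Partial derivative in the first coordinate direction. -/
noncomputable def pd1 (f : ℝ × ℝ → ℂ) (p : ℝ × ℝ) : ℂ := fderiv ℝ f p (1, 0)

/-- Partial derivative in the second coordinate direction. -/
noncomputable def pd2 (f : ℝ × ℝ → ℂ) (p : ℝ × ℝ) : ℂ := fderiv ℝ f p (0, 1)

/-- Product rule for `pd1`. -/
lemma pd1_mul {f h : ℝ × ℝ → ℂ} {p : ℝ × ℝ} (hf : DifferentiableAt ℝ f p)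
    (hh : DifferentiableAt ℝ h p) :
    pd1 (fun z => f z * h z) p = pd1 f p * h p + f p * pd1 h p := by
  simp only [pd1, fderiv_fun_mul hf hh, add_apply, smul_apply, smul_eq_mul]
  ring

/-- Product rule for `pd2`. -/
lemma pd2_mul {f h : ℝ × ℝ → ℂ} {p : ℝ × ℝ} (hf : DifferentiableAt ℝ f p)
    (hh : DifferentiableAt ℝ h p) :
    pd2 (fun z => f z * h z) p = pd2 f p * h p + f p * pd2 h p := by
  simp only [pd2, fderiv_fun_mul hf hh, add_apply, smul_apply, smul_eq_mul]
  ring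

lemma pd1_sub {f h : ℝ × ℝ → ℂ} {p : ℝ × ℝ} (hf : DifferentiableAt ℝ f p)
    (hh : DifferentiableAt ℝ h p) :
    pd1 (fun z => f z - h z) p = pd1 f p - pd1 h p := by
  simp [pd1, fderiv_fun_sub hf hh]

lemma pd2_sub {f h : ℝ × ℝ → ℂ} {p : ℝ × ℝ} (hf : DifferentiableAt ℝ f p)
    (hh : DifferentiableAt ℝ h p) :
    pd2 (fun z => f z - h z) p = pd2 f p - pd2 h p := by
  simp [pd2, fderiv_fun_sub hf hh]

lemma pd2_add {f h : ℝ × ℝ → ℂ} {p : ℝ × ℝ} (hf : DifferentiableAt ℝ f p)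
    (hh : DifferentiableAt ℝ h p) :
    pd2 (fun z => f z + h z) p = pd2 f p + pd2 h p := by
  simp [pd2, fderiv_fun_add hf hh]

lemma contDiff_pd1 {f : ℝ × ℝ → ℂ} (hf : ContDiff ℝ 2 f) : ContDiff ℝ 1 (pd1 f) :=
  (hf.fderiv_right (m := 1) (by norm_num)).clm_apply contDiff_const

lemma contDiff_pd2 {f : ℝ × ℝ → ℂ} (hf : ContDiff ℝ 2 f) : ContDiff ℝ 1 (pd2 f) :=
  (hf.fderiv_right (m := 1) (by norm_num)).clm_apply contDiff_const

lemma continuous_pd1 {f : ℝ × ℝ → ℂ} (hf : ContDiff ℝ 1 f) : Continuous (pd1 f) :=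
  (hf.continuous_fderiv (by norm_num)).clm_apply continuous_const

lemma continuous_pd2 {f : ℝ × ℝ → ℂ} (hf : ContDiff ℝ 1 f) : Continuous (pd2 f) :=
  (hf.continuous_fderiv (by norm_num)).clm_apply continuous_const

lemma norm_pd1_le (f : ℝ × ℝ → ℂ) (p : ℝ × ℝ) : ‖pd1 f p‖ ≤ ‖fderiv ℝ f p‖ := by
  simpa [pd1, Prod.norm_def] using (fderiv ℝ f p).le_opNorm (1, 0)

lemma norm_pd2_le (f : ℝ × ℝ → ℂ) (p : ℝ × ℝ) : ‖pd2 f p‖ ≤ ‖fderiv ℝ f p‖ := by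
  simpa [pd2, Prod.norm_def] using (fderiv ℝ f p).le_opNorm (0, 1)

lemma hasFDerivAt_ofReal_comp_snd {β : ℝ → ℝ} (p : ℝ × ℝ) (hβ : DifferentiableAt ℝ β p.2) :
    HasFDerivAt (fun w : ℝ × ℝ => (β w.2 : ℂ))
      ((ContinuousLinearMap.snd ℝ ℝ ℝ).smulRight ((deriv β p.2 : ℝ) : ℂ)) p := by
  refine (hβ.hasDerivAt.ofReal_comp.hasFDerivAt.comp p
    (hasFDerivAt_snd (𝕜 := ℝ))).congr_fderiv ?_
  ext <;> simp

lemma pd1_ofReal_comp_snd {β : ℝ → ℝ} (p : ℝ × ℝ) (hβ : DifferentiableAt ℝ β p.2) :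
    pd1 (fun w : ℝ × ℝ => (β w.2 : ℂ)) p = 0 := by
  simp [pd1, (hasFDerivAt_ofReal_comp_snd p hβ).fderiv]

lemma pd2_ofReal_comp_snd {β : ℝ → ℝ} (p : ℝ × ℝ) (hβ : DifferentiableAt ℝ β p.2) :
    pd2 (fun w : ℝ × ℝ => (β w.2 : ℂ)) p = ((deriv β p.2 : ℝ) : ℂ) := by
  simp [pd2, (hasFDerivAt_ofReal_comp_snd p hβ).fderiv]

/-- The derivative of a `C¹` function vanishes on the closure of an open set on which the function
is constant. -/
lemma deriv_eq_zero_of_mem_closure {f : ℝ → ℝ} (hf : ContDiff ℝ 1 f) {s : Set ℝ} (hs : IsOpen s)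
    {m : ℝ} (hm : ∀ t ∈ s, f t = m) {t : ℝ} (ht : t ∈ closure s) : deriv f t = 0 := by
  have hcl : IsClosed {t | deriv f t = 0} :=
    isClosed_eq (hf.continuous_deriv (by norm_num)) continuous_const
  refine closure_minimal (fun x hx => ?_) hcl ht
  have : f =ᶠ[nhds x] fun _ => m := Filter.eventuallyEq_of_mem (hs.mem_nhds hx) hm
  simp [this.deriv_eq]

lemma exists_forall_norm_le_of_eq_outside {f : ℝ → ℝ} (hf : Continuous f) {a b m₁ m₂ : ℝ}
    (h₁ : ∀ t ≤ a, f t = m₁) (h₂ : ∀ t, b ≤ t → f t = m₂) : ∃ M, ∀ t, ‖f t‖ ≤ M := by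
  obtain ⟨M, hM⟩ := (isCompact_Icc (a := a) (b := b)).exists_bound_of_continuousOn hf.continuousOn
  refine ⟨max M (max ‖m₁‖ ‖m₂‖), fun t => ?_⟩
  rcases le_total t a with h | h
  · simp [h₁ t h]
  rcases le_total b t with h' | h'
  · simp [h₂ t h']
  · exact (hM t ⟨h, h'⟩).trans (le_max_left _ _)

/-- Green's identity in divergence form for the operator `∂₁(a₁∂₁·) + ∂₂(a₂∂₂·)`. -/
lemma pd_green_identity {a₁ a₂ v g : ℝ × ℝ → ℂ} (ha₁ : ContDiff ℝ 1 a₁) (ha₂ : ContDiff ℝ 1 a₂)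
    (hv : ContDiff ℝ 2 v) (hg : ContDiff ℝ 2 g) (y : ℝ × ℝ) :
    pd1 (fun z => g z * (a₁ z * pd1 v z) - v z * (a₁ z * pd1 g z)) y
        + pd2 (fun z => g z * (a₂ z * pd2 v z) - v z * (a₂ z * pd2 g z)) y
      = g y * (pd1 (fun z => a₁ z * pd1 v z) y + pd2 (fun z => a₂ z * pd2 v z) y)
        - v y * (pd1 (fun z => a₁ z * pd1 g z) y + pd2 (fun z => a₂ z * pd2 g z) y) := by
  have dv := hv.differentiable (by norm_num) y
  have dg := hg.differentiable (by norm_num) y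
  have d1v := (ha₁.mul (contDiff_pd1 hv)).differentiable (by norm_num) y
  have d2v := (ha₂.mul (contDiff_pd2 hv)).differentiable (by norm_num) y
  have d1g := (ha₁.mul (contDiff_pd1 hg)).differentiable (by norm_num) y
  have d2g := (ha₂.mul (contDiff_pd2 hg)).differentiable (by norm_num) y
  rw [pd1_sub (dg.fun_mul d1v) (dv.fun_mul d1g), pd2_sub (dg.fun_mul d2v) (dv.fun_mul d2g),
    pd1_mul dg d1v, pd1_mul dv d1g, pd2_mul dg d2v, pd2_mul dv d2g]
  ring

/-- Leibniz expansion of `∂₁(a₁∂₁(βu)) + ∂₂(a₂∂₂(βu))` for `β` depending on the second variable. -/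
lemma pd_operator_cutoff_mul {a₁ a₂ u : ℝ × ℝ → ℂ} {β : ℝ → ℝ} (ha₁ : ContDiff ℝ 1 a₁)
    (ha₂ : ContDiff ℝ 1 a₂) (hu : ContDiff ℝ 2 u) (hβ : ContDiff ℝ 2 β) (y : ℝ × ℝ) :
    pd1 (fun z => a₁ z * pd1 (fun w => (β w.2 : ℂ) * u w) z) y
        + pd2 (fun z => a₂ z * pd2 (fun w => (β w.2 : ℂ) * u w) z) y
      = β y.2 * (pd1 (fun z => a₁ z * pd1 u z) y + pd2 (fun z => a₂ z * pd2 u z) y)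
        + pd2 a₂ y * ((deriv β y.2 : ℝ) * u y) + a₂ y * ((deriv (deriv β) y.2 : ℝ) * u y)
        + 2 * (a₂ y * ((deriv β y.2 : ℝ) * pd2 u y)) := by
  have hβd : Differentiable ℝ β := hβ.differentiable (by norm_num)
  have hβ' : ContDiff ℝ 1 (deriv β) := ContDiff.deriv' hβ
  have hβ'd : Differentiable ℝ (deriv β) := hβ'.differentiable (by norm_num)
  have hud : Differentiable ℝ u := hu.differentiable (by norm_num)
  have hbd : Differentiable ℝ fun w : ℝ × ℝ => (β w.2 : ℂ) :=
    fun p => (hasFDerivAt_ofReal_comp_snd p (hβd _)).differentiableAt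
  have hb'd : Differentiable ℝ fun w : ℝ × ℝ => ((deriv β w.2 : ℝ) : ℂ) :=
    fun p => (hasFDerivAt_ofReal_comp_snd p (hβ'd _)).differentiableAt
  have d1 := (ha₁.mul (contDiff_pd1 hu)).differentiable (by norm_num)
  have d2 := (ha₂.mul (contDiff_pd2 hu)).differentiable (by norm_num)
  have da := ha₂.differentiable (by norm_num)
  have e1 : (fun z => a₁ z * pd1 (fun w => (β w.2 : ℂ) * u w) z)
      = fun z => (β z.2 : ℂ) * (a₁ z * pd1 u z) := by
    funext z
    rw [pd1_mul (hbd z) (hud z), pd1_ofReal_comp_snd z (hβd _)]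
    ring
  have e2 : (fun z => a₂ z * pd2 (fun w => (β w.2 : ℂ) * u w) z)
      = fun z => a₂ z * (((deriv β z.2 : ℝ) : ℂ) * u z) + (β z.2 : ℂ) * (a₂ z * pd2 u z) := by
    funext z
    rw [pd2_mul (hbd z) (hud z), pd2_ofReal_comp_snd z (hβd _)]
    ring
  rw [e1, e2, pd1_mul (hbd y) (d1 y), pd1_ofReal_comp_snd y (hβd _),
    pd2_add ((da y).fun_mul ((hb'd y).fun_mul (hud y))) ((hbd y).fun_mul (d2 y)),
    pd2_mul (da y) ((hb'd y).fun_mul (hud y)), pd2_mul (hb'd y) (hud y),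
    pd2_mul (hbd y) (d2 y), pd2_ofReal_comp_snd y (hβd _), pd2_ofReal_comp_snd y (hβ'd _)]
  ring

lemma integrable_exp_neg_mul_norm {c : ℝ} (hc : 0 < c) :
    Integrable fun y : ℝ × ℝ => Real.exp (-c * ‖y‖) := by
  have h : Integrable fun y : ℝ × ℝ => (1 + ‖y‖) ^ (-(3 : ℝ)) :=
    integrable_one_add_norm (by simp; norm_num)
  refine (h.const_mul (6 * Real.exp c / c ^ 3)).mono' (by fun_prop) (.of_forall fun y => ?_)
  have hy : 0 < 1 + ‖y‖ := by positivity
  have h3 := Real.pow_div_factorial_le_exp (c * (1 + ‖y‖)) (by positivity) 3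
  have hsplit : Real.exp (c * (1 + ‖y‖)) * Real.exp (-c * ‖y‖) = Real.exp c := by
    rw [← Real.exp_add]
    ring_nf
  have h4 := mul_le_mul_of_nonneg_right h3 (Real.exp_pos (-c * ‖y‖)).le
  rw [hsplit] at h4
  rw [Real.norm_eq_abs, abs_of_pos (Real.exp_pos _), Real.rpow_neg hy.le,
    show (3 : ℝ) = (3 : ℕ) by norm_num, Real.rpow_natCast, ← div_eq_mul_inv,
    le_div_iff₀ (by positivity), le_div_iff₀ (by positivity)]
  norm_num [Nat.factorial] at h4
  rw [neg_mul]
  linarith [mul_pow c (1 + ‖y‖) 3, show (c * (1 + ‖y‖)) ^ 3 / 6 * Real.exp (-(c * ‖y‖))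
    = (Real.exp (-(c * ‖y‖)) * (1 + ‖y‖) ^ 3 * c ^ 3) / 6 by ring]

/-- The integral over the plane of the divergence of an exponentially decaying `C¹` field is zero. -/
lemma integral_divergence_eq_zero_of_exp_decay {f h : ℝ × ℝ → ℂ} (hf : ContDiff ℝ 1 f)
    (hh : ContDiff ℝ 1 h) {K c : ℝ} (hc : 0 < c)
    (hfK : ∀ y, ‖f y‖ ≤ K * Real.exp (-c * ‖y‖)) (hhK : ∀ y, ‖h y‖ ≤ K * Real.exp (-c * ‖y‖))
    (hi : Integrable fun y => pd1 f y + pd2 h y) :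
    ∫ y, (pd1 f y + pd2 h y) = 0 := by
  have hK : 0 ≤ K := by simpa using (norm_nonneg _).trans (hfK 0)
  have hcov : AECover (volume : Measure (ℝ × ℝ)) Filter.atTop
      fun R : ℝ => Set.Icc (-R, -R) (R, R) := by
    refine ⟨.of_forall fun y => ?_, fun R => measurableSet_Icc⟩
    filter_upwards [Filter.eventually_ge_atTop ‖y‖] with R hR
    have h1 := abs_le.1 ((norm_fst_le y).trans hR)
    have h2 := abs_le.1 ((norm_snd_le y).trans hR)
    exact ⟨⟨h1.1, h2.1⟩, ⟨h1.2, h2.2⟩⟩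
  refine tendsto_nhds_unique (hcov.integral_tendsto_of_countably_generated hi) ?_
  have hlim : Filter.Tendsto (fun R : ℝ => 8 * K * (R * Real.exp (-c * R))) Filter.atTop
      (nhds 0) := by
    simpa using (tendsto_rpow_mul_exp_neg_mul_atTop_nhds_zero 1 c hc).const_mul (8 * K)
  refine squeeze_zero_norm' ?_ hlim
  filter_upwards [Filter.eventually_ge_atTop 0] with R hR
  have hdiv := integral_divergence_prod_Icc_of_hasFDerivAt_of_le f h (fderiv ℝ f) (fderiv ℝ h)
    (-R, -R) (R, R) ⟨by simpa using hR, by simpa using hR⟩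
    hf.continuous.continuousOn hh.continuous.continuousOn
    (fun x _ => (hf.differentiable (by norm_num) x).hasFDerivAt)
    (fun x _ => (hh.differentiable (by norm_num) x).hasFDerivAt) hi.integrableOn
  have hedge : ∀ {φ : ℝ → ℂ} (q : ℝ → ℝ × ℝ), (∀ t, R ≤ ‖q t‖) →
      (∀ t, ‖φ t‖ ≤ K * Real.exp (-c * ‖q t‖)) →
      ‖∫ t in (-R)..R, φ t‖ ≤ 2 * K * (R * Real.exp (-c * R)) := by
    intro φ q hq hφ
    refine (intervalIntegral.norm_integral_le_of_norm_le_const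
      (C := K * Real.exp (-c * R)) fun t _ => (hφ t).trans ?_).trans_eq ?_
    · gcongr ?_ * Real.exp ?_
      nlinarith [hq t]
    · rw [abs_of_nonneg (by linarith)]
      ring
  have hRabs : R ≤ |R| := le_abs_self R
  have b1 := hedge (φ := fun t => h (t, R)) (fun t => (t, R))
    (fun t => by simp [Prod.norm_def, hRabs]) fun t => hhK _
  have b2 := hedge (φ := fun t => h (t, -R)) (fun t => (t, -R))
    (fun t => by simp [Prod.norm_def, hRabs]) fun t => hhK _
  have b3 := hedge (φ := fun t => f (R, t)) (fun t => (R, t))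
    (fun t => by simp [Prod.norm_def, hRabs]) fun t => hfK _
  have b4 := hedge (φ := fun t => f (-R, t)) (fun t => (-R, t))
    (fun t => by simp [Prod.norm_def, hRabs]) fun t => hfK _
  simp only [pd1, pd2]
  rw [hdiv]
  refine (norm_sub_le _ _).trans ?_
  refine (add_le_add_left ((norm_add_le _ _).trans
    (add_le_add_left (norm_sub_le _ _) _)) _).trans ?_
  linarith

lemma ae_snd_ne (m : ℝ) : ∀ᵐ y : ℝ × ℝ, y.2 ≠ m :=
  Measure.quasiMeasurePreserving_snd.ae (volume.ae_ne m)

/-- Theorem 2.2(i) of the paper (classical form): the downward source transfer identity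
`∫_{Ω_i} f̄ J g = ∫_{Ω_{i-1}} Ψ g`. -/
theorem stmt_2
    (k : ℝ) (hk : 0 < k)
    (ζim1 ζi ζi1 : ℝ) (hζ1 : ζim1 < ζi) (hζ2 : ζi < ζi1)
    (a₁ a₂ J u g fbar : ℝ × ℝ → ℂ) (β : ℝ → ℝ)
    (ha₁ : ContDiff ℝ 1 a₁) (ha₂ : ContDiff ℝ 1 a₂) (hJ : ContDiff ℝ 1 J)
    (hbdd : ∃ B : ℝ, ∀ y : ℝ × ℝ, ζim1 < y.2 →
      ‖a₁ y‖ ≤ B ∧ ‖fderiv ℝ a₁ y‖ ≤ B ∧ ‖a₂ y‖ ≤ B ∧ ‖fderiv ℝ a₂ y‖ ≤ B ∧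
      ‖J y‖ ≤ B ∧ ‖fderiv ℝ J y‖ ≤ B)
    (hu : ContDiff ℝ 2 u)
    (hfbar_bdd : ∃ B : ℝ, ∀ y, ‖fbar y‖ ≤ B)
    (hfbar_supp : Function.support fbar ⊆ closure {x : ℝ × ℝ | ζi < x.2 ∧ x.2 < ζi1})
    (hueq : ∀ y : ℝ × ℝ,
      pd1 (fun z => a₁ z * pd1 u z) y + pd2 (fun z => a₂ z * pd2 u z) y
        + (k : ℂ) ^ 2 * J y * u y = -(J y * fbar y))
    (ζ' : ℝ) (hζ' : ζ' < ζim1)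
    (hg : ContDiff ℝ 2 g)
    (hgeq : ∀ y : ℝ × ℝ, ζ' < y.2 →
      pd1 (fun z => a₁ z * pd1 g z) y + pd2 (fun z => a₂ z * pd2 g z) y
        + (k : ℂ) ^ 2 * J y * g y = 0)
    (hdecay : ∃ C c : ℝ, 0 < C ∧ 0 < c ∧ ∀ y : ℝ × ℝ, ζim1 < y.2 →
      ‖u y‖ + ‖fderiv ℝ u y‖ + ‖g y‖ + ‖fderiv ℝ g y‖ ≤ C * Real.exp (-c * ‖y‖))
    (hβ : ContDiff ℝ 2 β)
    (hβ0 : ∀ t : ℝ, t ≤ ζim1 → β t = 0) (hβ1 : ∀ t : ℝ, ζi ≤ t → β t = 1) :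
    ∫ y in {x : ℝ × ℝ | ζi < x.2 ∧ x.2 < ζi1}, fbar y * J y * g y
      = ∫ y in {x : ℝ × ℝ | ζim1 < x.2 ∧ x.2 < ζi},
          (pd1 (fun z => a₁ z * pd1 (fun w => (β w.2 : ℂ) * u w) z) y
            + pd2 (fun z => a₂ z * pd2 (fun w => (β w.2 : ℂ) * u w) z) y
            + (k : ℂ) ^ 2 * J y * (β y.2 : ℂ) * u y) * g y := by
  obtain ⟨B, hB⟩ := hbdd
  obtain ⟨Bf, hBf⟩ := hfbar_bdd
  obtain ⟨C, c, hC, hc, hdec⟩ := hdecay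
  have hβ' : ContDiff ℝ 1 (deriv β) := ContDiff.deriv' hβ
  have hβ'0 : ∀ t ≤ ζim1, deriv β t = 0 := fun t ht =>
    deriv_eq_zero_of_mem_closure (hβ.of_le (by norm_num)) isOpen_Iio
      (fun s hs => hβ0 s (le_of_lt hs)) (by simpa using ht)
  have hβ'1 : ∀ t, ζi ≤ t → deriv β t = 0 := fun t ht =>
    deriv_eq_zero_of_mem_closure (hβ.of_le (by norm_num)) isOpen_Ioi
      (fun s hs => hβ1 s (le_of_lt hs)) (by simpa using ht)
  have hβ''0 : ∀ t ≤ ζim1, deriv (deriv β) t = 0 := fun t ht =>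
    deriv_eq_zero_of_mem_closure hβ' isOpen_Iio (fun s hs => hβ'0 s (le_of_lt hs))
      (by simpa using ht)
  have hβ''1 : ∀ t, ζi ≤ t → deriv (deriv β) t = 0 := fun t ht =>
    deriv_eq_zero_of_mem_closure hβ' isOpen_Ioi (fun s hs => hβ'1 s (le_of_lt hs))
      (by simpa using ht)
  obtain ⟨M₀, hM₀⟩ := exists_forall_norm_le_of_eq_outside hβ.continuous hβ0 hβ1
  obtain ⟨M₁, hM₁⟩ := exists_forall_norm_le_of_eq_outside hβ'.continuous hβ'0 hβ'1
  obtain ⟨M₂, hM₂⟩ := exists_forall_norm_le_of_eq_outside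
    (hβ'.continuous_deriv (by norm_num)) hβ''0 hβ''1
  obtain ⟨M, hMB, hMBf, hMC, hM0, hM1, hM2⟩ :
      ∃ M, B ≤ M ∧ Bf ≤ M ∧ C ≤ M ∧ M₀ ≤ M ∧ M₁ ≤ M ∧ M₂ ≤ M :=
    ⟨max B (max Bf (max C (max M₀ (max M₁ M₂)))), by simp⟩
  have hMpos : 0 ≤ M := hC.le.trans hMC
  have hv : ContDiff ℝ 2 fun w : ℝ × ℝ => (β w.2 : ℂ) * u w :=
    (Complex.ofRealCLM.contDiff.comp (hβ.comp contDiff_snd)).mul hu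
  have hv1 : ∀ y : ℝ × ℝ, pd1 (fun w => (β w.2 : ℂ) * u w) y = β y.2 * pd1 u y := fun y => by
    have hd := hβ.differentiable (by norm_num) y.2
    rw [pd1_mul (hasFDerivAt_ofReal_comp_snd y hd).differentiableAt
      (hu.differentiable (by norm_num) y), pd1_ofReal_comp_snd y hd]
    ring
  have hv2 : ∀ y : ℝ × ℝ, pd2 (fun w => (β w.2 : ℂ) * u w) y
      = (deriv β y.2 : ℝ) * u y + β y.2 * pd2 u y := fun y => by
    have hd := hβ.differentiable (by norm_num) y.2
    rw [pd2_mul (hasFDerivAt_ofReal_comp_snd y hd).differentiableAt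
      (hu.differentiable (by norm_num) y), pd2_ofReal_comp_snd y hd]
  set v : ℝ × ℝ → ℂ := fun w => (β w.2 : ℂ) * u w with hvdef
  have hv0 : ∀ y, v y = β y.2 * u y := fun _ => rfl
  set Ψ : ℝ × ℝ → ℂ := fun y => pd1 (fun z => a₁ z * pd1 v z) y
    + pd2 (fun z => a₂ z * pd2 v z) y + (k : ℂ) ^ 2 * J y * (β y.2 : ℂ) * u y with hΨ
  have hΨeq : ∀ y, Ψ y = -(β y.2 * (J y * fbar y)) + pd2 a₂ y * ((deriv β y.2 : ℝ) * u y)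
      + a₂ y * ((deriv (deriv β) y.2 : ℝ) * u y) + 2 * (a₂ y * ((deriv β y.2 : ℝ) * pd2 u y)) := by
    intro y
    simp only [hΨ, hvdef]
    rw [pd_operator_cutoff_mul ha₁ ha₂ hu hβ]
    linear_combination (β y.2 : ℂ) * hueq y
  have hΨ_below : ∀ y : ℝ × ℝ, y.2 ≤ ζim1 → Ψ y = 0 := fun y hy => by
    simp [hΨeq, hβ0 _ hy, hβ'0 _ hy, hβ''0 _ hy]
  have hΨ_above : ∀ y : ℝ × ℝ, ζi ≤ y.2 → Ψ y = -(J y * fbar y) := fun y hy => by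
    simp [hΨeq, hβ1 _ hy, hβ'1 _ hy, hβ''1 _ hy]
  let W₁ : ℝ × ℝ → ℂ := fun z => g z * (a₁ z * pd1 v z) - v z * (a₁ z * pd1 g z)
  let W₂ : ℝ × ℝ → ℂ := fun z => g z * (a₂ z * pd2 v z) - v z * (a₂ z * pd2 g z)
  have hg1 : ContDiff ℝ 1 g := hg.of_le (by norm_num)
  have hv1' : ContDiff ℝ 1 v := hv.of_le (by norm_num)
  have hW₁ : ContDiff ℝ 1 W₁ :=
    (hg1.mul (ha₁.mul (contDiff_pd1 hv))).sub (hv1'.mul (ha₁.mul (contDiff_pd1 hg)))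
  have hW₂ : ContDiff ℝ 1 W₂ :=
    (hg1.mul (ha₂.mul (contDiff_pd2 hv))).sub (hv1'.mul (ha₂.mul (contDiff_pd2 hg)))
  have hdiv : ∀ y, pd1 W₁ y + pd2 W₂ y = Ψ y * g y := fun y => by
    simp only [W₁, W₂]
    rw [pd_green_identity ha₁ ha₂ hv hg]
    rcases le_or_gt y.2 ζim1 with hy | hy
    · simp [hΨ, hvdef, hβ0 _ hy]
      ring
    · have := hgeq y (hζ'.trans hy)
      simp only [hΨ, hvdef] at this ⊢
      linear_combination -(β y.2 : ℂ) * u y * this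
  have hbounds : ∀ y : ℝ × ℝ, ‖W₁ y‖ ≤ 5 * M ^ 3 * M * Real.exp (-c * ‖y‖) ∧
      ‖W₂ y‖ ≤ 5 * M ^ 3 * M * Real.exp (-c * ‖y‖) ∧
      ‖Ψ y * g y‖ ≤ 5 * M ^ 3 * M * Real.exp (-c * ‖y‖) := by
    intro y
    rcases le_or_gt y.2 ζim1 with hy | hy
    · refine ⟨?_, ?_, ?_⟩
      · simp [W₁, hv1, hv0, hβ0 _ hy]
        positivity
      · simp [W₂, hv2, hv0, hβ0 _ hy, hβ'0 _ hy]
        positivity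
      · simp [hΨ_below y hy]
        positivity
    set E := Real.exp (-c * ‖y‖)
    obtain ⟨hb1, -, hb2, hb2', hbJ, -⟩ := hB y hy
    have hE : 0 < E := Real.exp_pos _
    have hE1 : E ≤ 1 := Real.exp_le_one_iff.2 (by nlinarith [norm_nonneg y])
    have hCE : C * E ≤ M * E := by gcongr
    have hME : M * E ≤ M := mul_le_of_le_one_right hMpos hE1
    have hd := hdec y hy
    have nu := norm_nonneg (u y)
    have nu' := norm_nonneg (fderiv ℝ u y)
    have ng := norm_nonneg (g y)
    have ng' := norm_nonneg (fderiv ℝ g y)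
    have ku : ‖u y‖ ≤ M := by linarith
    have ku1 : ‖pd1 u y‖ ≤ M := (norm_pd1_le u y).trans (by linarith)
    have ku2 : ‖pd2 u y‖ ≤ M := (norm_pd2_le u y).trans (by linarith)
    have kg : ‖g y‖ ≤ M * E := by linarith
    have kg1 : ‖pd1 g y‖ ≤ M * E := (norm_pd1_le g y).trans (by linarith)
    have kg2 : ‖pd2 g y‖ ≤ M * E := (norm_pd2_le g y).trans (by linarith)
    have ka1 : ‖a₁ y‖ ≤ M := hb1.trans hMB
    have ka2 : ‖a₂ y‖ ≤ M := hb2.trans hMB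
    have ka2' : ‖pd2 a₂ y‖ ≤ M := (norm_pd2_le a₂ y).trans (hb2'.trans hMB)
    have kJ : ‖J y‖ ≤ M := hbJ.trans hMB
    have kf : ‖fbar y‖ ≤ M := (hBf y).trans hMBf
    have kb : ‖(β y.2 : ℂ)‖ ≤ M := by simpa using (hM₀ y.2).trans hM0
    have kb' : ‖((deriv β y.2 : ℝ) : ℂ)‖ ≤ M := by simpa using (hM₁ y.2).trans hM1
    have kb'' : ‖((deriv (deriv β) y.2 : ℝ) : ℂ)‖ ≤ M := by simpa using (hM₂ y.2).trans hM2
    have hmul : ∀ {p q r : ℂ}, ‖p‖ ≤ M → ‖q‖ ≤ M → ‖r‖ ≤ M → ‖p * (q * r)‖ ≤ M ^ 3 := by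
      intro p q r hp hq hr
      calc ‖p * (q * r)‖ = ‖p‖ * (‖q‖ * ‖r‖) := by rw [norm_mul, norm_mul]
        _ ≤ M * (M * M) := by gcongr
        _ = M ^ 3 := by ring
    have hmulE : ∀ {p q : ℂ} {n : ℝ}, 0 ≤ n → ‖p‖ ≤ n * M ^ 3 → ‖q‖ ≤ M * E →
        ‖p * q‖ ≤ n * (M ^ 3 * M * E) := by
      intro p q n hn hp hq
      calc ‖p * q‖ = ‖p‖ * ‖q‖ := norm_mul _ _
        _ ≤ (n * M ^ 3) * (M * E) := by gcongr
        _ = n * (M ^ 3 * M * E) := by ring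
    have hpos : 0 ≤ M ^ 3 * M * E := by positivity
    have hsum : ∀ {p q r s : ℂ}, ‖p‖ ≤ M ^ 3 → ‖q‖ ≤ M ^ 3 → ‖r‖ ≤ M ^ 3 → ‖s‖ ≤ M ^ 3 →
        ‖-p + q + r + 2 * s‖ ≤ 5 * M ^ 3 := by
      intro p q r s hp hq hr hs
      have h2 : ‖2 * s‖ = 2 * ‖s‖ := by simp
      linarith [norm_add₄_le (a := -p) (b := q) (c := r) (d := 2 * s), norm_neg p]
    refine ⟨?_, ?_, ?_⟩
    · have e : W₁ y = a₁ y * (β y.2 * pd1 u y) * g y - a₁ y * (β y.2 * u y) * pd1 g y := by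
        simp only [W₁, hv1, hv0]
        ring
      rw [e]
      linarith [norm_sub_le (a₁ y * (β y.2 * pd1 u y) * g y) (a₁ y * (β y.2 * u y) * pd1 g y),
        hmulE (n := 1) zero_le_one ((hmul ka1 kb ku1).trans_eq (one_mul _).symm) kg,
        hmulE (n := 1) zero_le_one ((hmul ka1 kb ku).trans_eq (one_mul _).symm) kg1]
    · have e : W₂ y = a₂ y * ((deriv β y.2 : ℝ) * u y) * g y
          + a₂ y * (β y.2 * pd2 u y) * g y - a₂ y * (β y.2 * u y) * pd2 g y := by
        simp only [W₂, hv2, hv0]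
        ring
      rw [e]
      linarith [norm_sub_le (a₂ y * ((deriv β y.2 : ℝ) * u y) * g y
          + a₂ y * (β y.2 * pd2 u y) * g y) (a₂ y * (β y.2 * u y) * pd2 g y),
        norm_add_le (a₂ y * ((deriv β y.2 : ℝ) * u y) * g y) (a₂ y * (β y.2 * pd2 u y) * g y),
        hmulE (n := 1) zero_le_one ((hmul ka2 kb' ku).trans_eq (one_mul _).symm) kg,
        hmulE (n := 1) zero_le_one ((hmul ka2 kb ku2).trans_eq (one_mul _).symm) kg,
        hmulE (n := 1) zero_le_one ((hmul ka2 kb ku).trans_eq (one_mul _).symm) kg2]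
    · have hn : ‖Ψ y‖ ≤ 5 * M ^ 3 := by
        rw [hΨeq]
        exact hsum (hmul kb kJ kf) (hmul ka2' kb' ku) (hmul ka2 kb'' ku) (hmul ka2 kb' ku2)
      linarith [hmulE (by norm_num) hn kg]
  have hint : Integrable fun y => pd1 W₁ y + pd2 W₂ y :=
    ((integrable_exp_neg_mul_norm hc).const_mul _).mono'
      ((continuous_pd1 hW₁).add (continuous_pd2 hW₂)).aestronglyMeasurable
      (.of_forall fun y => (congrArg norm (hdiv y)).trans_le (hbounds y).2.2)
  have hzero := integral_divergence_eq_zero_of_exp_decay hW₁ hW₂ hc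
    (fun y => (hbounds y).1) (fun y => (hbounds y).2.1) hint
  simp only [hdiv] at hzero hint
  have hmeas : ∀ a b : ℝ, MeasurableSet {x : ℝ × ℝ | a < x.2 ∧ x.2 < b} := fun a b =>
    (measurableSet_lt measurable_const measurable_snd).inter
      (measurableSet_lt measurable_snd measurable_const)
  have hdisj : Disjoint {x : ℝ × ℝ | ζi < x.2 ∧ x.2 < ζi1} {x : ℝ × ℝ | ζim1 < x.2 ∧ x.2 < ζi} :=
    Set.disjoint_left.2 fun x h₁ h₂ => lt_asymm h₁.1 h₂.2
  have hfbar_above : ∀ y : ℝ × ℝ, ζi1 < y.2 → fbar y = 0 := fun y hy => by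
    by_contra hne
    have hcl : IsClosed {x : ℝ × ℝ | x.2 ≤ ζi1} := isClosed_le continuous_snd continuous_const
    exact absurd (closure_minimal (fun x hx => le_of_lt hx.2) hcl (hfbar_supp hne)) (not_le.2 hy)
  have hsplit : ∫ y in {x : ℝ × ℝ | ζi < x.2 ∧ x.2 < ζi1} ∪ {x : ℝ × ℝ | ζim1 < x.2 ∧ x.2 < ζi},
      Ψ y * g y = 0 := by
    rw [← hzero]
    refine setIntegral_eq_integral_of_ae_compl_eq_zero ?_
    filter_upwards [ae_snd_ne ζi, ae_snd_ne ζi1] with y hi hi1 hy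
    rcases le_or_gt y.2 ζim1 with h0 | h0
    · simp [hΨ_below y h0]
    rcases lt_or_gt_of_ne hi with h1 | h1
    · exact absurd (Or.inr ⟨h0, h1⟩) hy
    rcases lt_or_gt_of_ne hi1 with h2 | h2
    · exact absurd (Or.inl ⟨h1, h2⟩) hy
    · simp [hΨ_above y h1.le, hfbar_above y h2]
  rw [setIntegral_union hdisj (hmeas _ _) hint.integrableOn hint.integrableOn] at hsplit
  have hsrc : ∫ y in {x : ℝ × ℝ | ζi < x.2 ∧ x.2 < ζi1}, Ψ y * g y
      = -∫ y in {x : ℝ × ℝ | ζi < x.2 ∧ x.2 < ζi1}, fbar y * J y * g y := by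
    rw [← integral_neg]
    refine setIntegral_congr_fun (hmeas _ _) fun y hy => ?_
    simp only [hΨ_above y hy.1.le]
    ring
  rw [hsrc] at hsplit
  linear_combination -hsplit
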